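/- Let ℱ be a separable family of measurable functions f : 𝒳 → ℝ with measurable envelope F, and let 𝒢(ℱ) = {G_f : f ∈ ℱ} be the family of graphs of functions in ℱ. Suppose dim(𝒢(ℱ)) < ∞. If X = X₁, X₂, … is a stationary ergodic process with values in (𝒳, 𝒮) whose marginal distribution μ satisfies ∫ F dμ < ∞, then sup_{f ∈ ℱ} | n⁻¹ Σ_{i=1}^n f(X_i) − ∫ f dμ | → 0 almost surely as n → ∞. -/

import Mathlib

open MeasureTheory Set Filter

/-- `𝒞` shatters the finite set `D` if every subset of `D` is cut out by some `C ∈ 𝒞`. -/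
def Shatters {X : Type*} (𝒞 : Set (Set X)) (D : Finset X) : Prop :=
  ∀ B ⊆ D, ∃ C ∈ 𝒞, ∀ x ∈ D, x ∈ C ↔ x ∈ B

/-- `𝒞` has finite VC dimension: the cardinalities of shattered finite sets are bounded. -/
def FiniteVC {X : Type*} (𝒞 : Set (Set X)) : Prop :=
  ∃ k : ℕ, ∀ D : Finset X, Shatters 𝒞 D → D.card ≤ k

/-- `π` is a finite measurable partition of the whole space. -/
def IsFinitePartition {X : Type*} [MeasurableSpace X] (π : Set (Set X)) : Prop :=
  π.Finite ∧ (∀ A ∈ π, MeasurableSet A) ∧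
    (∀ A ∈ π, ∀ B ∈ π, A ≠ B → Disjoint A B) ∧ ⋃₀ π = Set.univ

/-- The `π`-boundary of `C`: union of the cells of `π` meeting both `C` and `Cᶜ`
with positive measure. -/
def piBoundary {X : Type*} [MeasurableSpace X] (μ : Measure X) (π : Set (Set X))
    (C : Set X) : Set X :=
  ⋃₀ {A ∈ π | 0 < μ (A ∩ C) * μ (A ∩ Cᶜ)}

/-- `𝒞` is finitely approximable w.r.t. `μ`: for every `ε > 0` there is a finite measurable
partition `π` such that `μ (∂(C : π)) ≤ ε` for every `C ∈ 𝒞`. -/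
def FinitelyApproximable {X : Type*} [MeasurableSpace X] (μ : Measure X)
    (𝒞 : Set (Set X)) : Prop :=
  ∀ ε : ENNReal, 0 < ε → ∃ π : Set (Set X), IsFinitePartition π ∧
    ∀ C ∈ 𝒞, μ (piBoundary μ π C) ≤ ε

/-- A family `ℱ` of real functions is separable if some countable subfamily `ℱ₀ ⊆ ℱ` is
pointwise dense in `ℱ`. -/
def SeparableFamily {X : Type*} (ℱ : Set (X → ℝ)) : Prop :=
  ∃ ℱ₀ ⊆ ℱ, ℱ₀.Countable ∧ ∀ f ∈ ℱ, ∃ g : ℕ → (X → ℝ), (∀ n, g n ∈ ℱ₀) ∧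
    ∀ x : X, Filter.Tendsto (fun n => g n x) Filter.atTop (nhds (f x))

/-- The graph of `f : X → ℝ`, a subset of `X × ℝ`. -/
def graphOf {X : Type*} (f : X → ℝ) : Set (X × ℝ) :=
  {p | (0 ≤ p.2 ∧ p.2 ≤ f p.1) ∨ (f p.1 ≤ p.2 ∧ p.2 ≤ 0)}

/-- The running maximum `max_{0 ≤ k ≤ n} S_k g` of the Birkhoff sums, in recursive form. -/
noncomputable def birkhoffMax {Ω : Type*} (T : Ω → Ω) (g : Ω → ℝ) : ℕ → Ω → ℝ
  | 0 => fun _ => 0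
  | n + 1 => fun x => max 0 (g x + birkhoffMax T g n (T x))

section BirkhoffMax

variable {Ω : Type*} {T : Ω → Ω} {g : Ω → ℝ}

theorem birkhoffMax_nonneg (n : ℕ) (x : Ω) : 0 ≤ birkhoffMax T g n x := by
  cases n with
  | zero => exact le_rfl
  | succ n => exact le_max_left _ _

theorem birkhoffMax_le_succ (n : ℕ) (x : Ω) :
    birkhoffMax T g n x ≤ birkhoffMax T g (n + 1) x := by
  induction n generalizing x with
  | zero => exact birkhoffMax_nonneg 1 x
  | succ n ih =>
    exact max_le_max le_rfl (by simpa using ih (T x))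

theorem birkhoffMax_mono (x : Ω) : Monotone fun n => birkhoffMax T g n x :=
  monotone_nat_of_le_succ fun n => birkhoffMax_le_succ n x

theorem birkhoffSum_le_birkhoffMax (n : ℕ) (x : Ω) :
    birkhoffSum T g n x ≤ birkhoffMax T g n x := by
  induction n generalizing x with
  | zero => simp [birkhoffMax]
  | succ n ih =>
    rw [birkhoffSum_succ']
    exact le_max_of_le_right (by simpa using ih (T x))

theorem integrable_birkhoffMax [MeasurableSpace Ω] {P : Measure Ω}
    (hT : MeasurePreserving T P P) (hg : Integrable g P) (n : ℕ) :
    Integrable (birkhoffMax T g n) P := by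
  induction n with
  | zero => exact integrable_zero _ _ _
  | succ n ih =>
    exact (integrable_zero _ _ _).sup (hg.add (hT.integrable_comp_of_integrable ih))

/-- If the Birkhoff sums are almost surely unbounded above, the integral is nonnegative. -/
theorem integral_nonneg_of_ae_unbounded_birkhoffSum [MeasurableSpace Ω] {P : Measure Ω}
    (hT : MeasurePreserving T P P) (hg : Integrable g P)
    (h : ∀ᵐ x ∂P, ∀ K : ℝ, ∃ n, K < birkhoffSum T g n x) : 0 ≤ ∫ x, g x ∂P := by
  have hlim : Tendsto (fun n => ∫ x, (birkhoffMax T g (n + 1) x - birkhoffMax T g n (T x)) ∂P)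
      atTop (nhds (∫ x, g x ∂P)) := by
    refine tendsto_integral_of_dominated_convergence (fun x => |g x|) (fun n => ?_) hg.abs
      (fun n => ?_) ?_
    · exact ((integrable_birkhoffMax hT hg (n + 1)).sub
        (hT.integrable_comp_of_integrable (integrable_birkhoffMax hT hg n))).aestronglyMeasurable
    · refine ae_of_all _ fun x => ?_
      have h0 := birkhoffMax_nonneg (T := T) (g := g) n (T x)
      simp only [birkhoffMax, Real.norm_eq_abs]
      rcases max_cases 0 (g x + birkhoffMax T g n (T x)) with h1 | h1 <;>
        rcases abs_cases (g x) with h2 | h2 <;> rw [h1.1, abs_le] <;> constructor <;> linarith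
    · filter_upwards [hT.quasiMeasurePreserving.ae h] with x hx
      obtain ⟨N, hN⟩ := hx (-g x)
      refine tendsto_const_nhds.congr' ?_
      filter_upwards [eventually_ge_atTop N] with n hn
      have h1 := birkhoffMax_mono (T := T) (g := g) (T x) hn
      have h2 := birkhoffSum_le_birkhoffMax (T := T) (g := g) N (T x)
      simp only [birkhoffMax] at h1 ⊢
      rw [max_eq_right (by linarith)]
      ring
  refine ge_of_tendsto' hlim fun n => ?_
  have h1 := integrable_birkhoffMax hT hg n
  have h3 : Integrable (fun x => birkhoffMax T g n (T x)) P := hT.integrable_comp_of_integrable h1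
  rw [integral_sub (integrable_birkhoffMax hT hg (n + 1)) h3]
  have h2 : ∫ x, birkhoffMax T g n (T x) ∂P = ∫ x, birkhoffMax T g n x ∂P := by
    have := integral_map (μ := P) hT.measurable.aemeasurable (f := birkhoffMax T g n)
      (by rw [hT.map_eq]; exact h1.aestronglyMeasurable)
    rw [hT.map_eq] at this
    exact this.symm
  rw [h2, sub_nonneg]
  exact integral_mono h1 (integrable_birkhoffMax hT hg (n + 1)) (birkhoffMax_le_succ n)

theorem Ergodic.ae_bddAbove_birkhoffSum [MeasurableSpace Ω] {P : Measure Ω}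
    (hT : Ergodic T P) (hgm : Measurable g) (hg : Integrable g P) (hneg : ∫ x, g x ∂P < 0) :
    ∀ᵐ x ∂P, ∃ K : ℝ, ∀ n, birkhoffSum T g n x ≤ K := by
  set A : Set Ω := {x | ∀ K : ℕ, ∃ n, (K : ℝ) < birkhoffSum T g n x} with hA
  have hmem : ∀ x, x ∈ A ↔ ∀ K : ℝ, ∃ n, K < birkhoffSum T g n x := fun x =>
    ⟨fun h K => by
      obtain ⟨k, hk⟩ := exists_nat_gt K
      obtain ⟨n, hn⟩ := h k
      exact ⟨n, hk.trans hn⟩, fun h K => h K⟩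
  have hmeas : ∀ n, Measurable (birkhoffSum T g n) := fun n =>
    Finset.measurable_sum _ fun i _ => hgm.comp (hT.measurable.iterate i)
  have hAm : MeasurableSet A := by
    simp only [hA, ofPred_forall, ofPred_exists]
    exact MeasurableSet.iInter fun K => MeasurableSet.iUnion fun n =>
      measurableSet_lt measurable_const (hmeas n)
  have hinv : T ⁻¹' A = A := by
    ext x
    rw [mem_preimage, hmem, hmem]
    constructor
    · intro h K
      obtain ⟨n, hn⟩ := h (K - g x)
      exact ⟨n + 1, by rw [birkhoffSum_succ']; linarith⟩
    · intro h K
      obtain ⟨n, hn⟩ := h (max 0 (K + g x))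
      cases n with
      | zero => simp at hn
      | succ n =>
        rw [birkhoffSum_succ'] at hn
        exact ⟨n, by linarith [le_max_right 0 (K + g x)]⟩
  rcases hT.toPreErgodic.ae_empty_or_univ hAm hinv with h | h
  · filter_upwards [h.mem_iff] with x hx
    have : x ∉ A := fun hxA => hx.1 hxA
    rw [hmem] at this
    push Not at this
    exact this
  · refine absurd (integral_nonneg_of_ae_unbounded_birkhoffSum hT.toMeasurePreserving hg ?_)
      (not_le.2 hneg)
    filter_upwards [h.mem_iff] with x hx
    exact (hmem x).1 (hx.2 trivial)

theorem Ergodic.ae_eventually_birkhoffAverage_le [MeasurableSpace Ω] {P : Measure Ω}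
    [IsProbabilityMeasure P] (hT : Ergodic T P) (hgm : Measurable g) (hg : Integrable g P)
    {ε : ℝ} (hε : 0 < ε) :
    ∀ᵐ x ∂P, ∀ᶠ n in atTop, birkhoffAverage ℝ T g n x ≤ ∫ x, g x ∂P + ε := by
  have hint : Integrable (fun x => g x - (∫ x, g x ∂P + ε / 2)) P :=
    hg.sub (integrable_const _)
  have hneg : ∫ x, (g x - (∫ x, g x ∂P + ε / 2)) ∂P < 0 := by
    rw [integral_sub hg (integrable_const _)]
    simp
    linarith
  filter_upwards [hT.ae_bddAbove_birkhoffSum (hgm.sub_const _) hint hneg] with x hx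
  obtain ⟨K, hK⟩ := hx
  obtain ⟨N, hN⟩ := exists_nat_gt (K / (ε / 2))
  filter_upwards [eventually_ge_atTop (N + 1)] with n hn
  have hn0 : (0 : ℝ) < n := by exact_mod_cast (by omega : 0 < n)
  have h1 := hK n
  simp only [birkhoffSum, Finset.sum_sub_distrib, Finset.sum_const, Finset.card_range,
    nsmul_eq_mul] at h1
  have hNn : (N : ℝ) ≤ n := by exact_mod_cast (by omega : N ≤ n)
  have h2 : K < n * (ε / 2) := by
    rw [div_lt_iff₀ (by positivity)] at hN
    nlinarith
  rw [birkhoffAverage, birkhoffSum, smul_eq_mul, inv_mul_le_iff₀ hn0]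
  nlinarith

/-- **Birkhoff's pointwise ergodic theorem** for an ergodic transformation. -/
theorem Ergodic.ae_tendsto_birkhoffAverage [MeasurableSpace Ω] {P : Measure Ω}
    [IsProbabilityMeasure P] (hT : Ergodic T P) (hgm : Measurable g) (hg : Integrable g P) :
    ∀ᵐ x ∂P, Tendsto (fun n => birkhoffAverage ℝ T g n x) atTop (nhds (∫ x, g x ∂P)) := by
  have h1 : ∀ᵐ x ∂P, ∀ m : ℕ, ∀ᶠ n in atTop,
      birkhoffAverage ℝ T g n x ≤ ∫ x, g x ∂P + 1 / ((m : ℝ) + 1) :=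
    ae_all_iff.2 fun m => hT.ae_eventually_birkhoffAverage_le hgm hg (by positivity)
  have h2 : ∀ᵐ x ∂P, ∀ m : ℕ, ∀ᶠ n in atTop,
      birkhoffAverage ℝ T (-g) n x ≤ ∫ x, (-g) x ∂P + 1 / ((m : ℝ) + 1) :=
    ae_all_iff.2 fun m => hT.ae_eventually_birkhoffAverage_le hgm.neg hg.neg (by positivity)
  filter_upwards [h1, h2] with x hx1 hx2
  rw [Metric.tendsto_nhds]
  intro ε hε
  obtain ⟨m, hm⟩ := exists_nat_one_div_lt hε
  filter_upwards [hx1 m, hx2 m] with n hn1 hn2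
  have h3 : birkhoffAverage ℝ T (-g) n x = -birkhoffAverage ℝ T g n x := by
    simp [birkhoffAverage, birkhoffSum]
  have h4 : ∫ x, (-g) x ∂P = -∫ x, g x ∂P := by simp [integral_neg]
  rw [h3, h4] at hn2
  rw [Real.dist_eq, abs_lt]
  constructor <;> linarith

end BirkhoffMax

/-- A family with arbitrarily many members in general position (all Boolean atoms nonempty)
has infinite VC dimension. -/
theorem not_finiteVC_of_atoms_nonempty {X : Type*} {𝒞 : Set (Set X)}
    (h : ∀ m : ℕ, ∃ C : ℕ → Set X, (∀ i < m, C i ∈ 𝒞) ∧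
      ∀ s : Set ℕ, ∃ x, ∀ i < m, (x ∈ C i ↔ i ∈ s)) : ¬ FiniteVC 𝒞 := by
  classical
  rintro ⟨k, hk⟩
  obtain ⟨C, hC, hatom⟩ := h (Fintype.card (Set (Fin (k + 1))))
  let e : Set (Fin (k + 1)) ≃ Fin (Fintype.card (Set (Fin (k + 1)))) := Fintype.equivFin _
  choose x hx using fun j : Fin (k + 1) =>
    hatom {i | ∃ S : Set (Fin (k + 1)), j ∈ S ∧ (e S : ℕ) = i}
  have hmem : ∀ j S, x j ∈ C (e S) ↔ j ∈ S := by
    intro j S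
    rw [hx j (e S) (e S).2]
    constructor
    · rintro ⟨S', hS', heq⟩
      rwa [← e.injective (Fin.ext heq)]
    · exact fun hj => ⟨S, hj, rfl⟩
  have hinj : Function.Injective x := by
    intro j j' hjj
    have := (hmem j' {j}).1 (hjj ▸ (hmem j {j}).2 rfl)
    exact this.symm
  have := hk (Finset.univ.map ⟨x, hinj⟩) (by
    intro B _
    refine ⟨C (e {j | x j ∈ B}), hC _ (e _).2, ?_⟩
    intro y hy
    obtain ⟨j, -, rfl⟩ := Finset.mem_map.1 hy
    exact hmem j _)
  simp at this

/-- A class of sets closed under countable unions contains a set of maximal measure. -/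
theorem exists_forall_measure_le_of_iUnion_mem {X : Type*} [MeasurableSpace X] (μ : Measure X)
    {𝒩 : Set (Set X)} (h0 : ∅ ∈ 𝒩) (hU : ∀ S : ℕ → Set X, (∀ n, S n ∈ 𝒩) → ⋃ n, S n ∈ 𝒩) :
    ∃ N ∈ 𝒩, ∀ S ∈ 𝒩, μ S ≤ μ N := by
  obtain ⟨u, -, hu, hmem⟩ := exists_seq_tendsto_sSup (S := μ '' 𝒩) ⟨_, mem_image_of_mem _ h0⟩
    (OrderTop.bddAbove _)
  choose S hS hSu using hmem
  refine ⟨⋃ n, S n, hU S hS, fun R hR => ?_⟩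
  refine (le_sSup (mem_image_of_mem μ hR)).trans (le_of_tendsto' hu fun n => ?_)
  rw [← hSu n]
  exact measure_mono (subset_iUnion S n)

/-- The cell containing `x` of the partition generated by a finite set of measurable sets. -/
def genCell {X : Type*} [MeasurableSpace X] (𝒟 : Finset {S : Set X // MeasurableSet S})
    (x : X) : Set X :=
  {y | ∀ S ∈ 𝒟, y ∈ S.1 ↔ x ∈ S.1}

/-- The union of the generated cells which `C` splits into two parts of positive measure. -/
def genBoundary {X : Type*} [MeasurableSpace X] (μ : Measure X)
    (𝒟 : Finset {S : Set X // MeasurableSet S}) (C : Set X) : Set X :=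
  {x | μ (genCell 𝒟 x ∩ C) ≠ 0 ∧ μ (genCell 𝒟 x \ C) ≠ 0}

section Approximation

variable {X : Type*} [MeasurableSpace X] {μ : Measure X}

theorem genCell_anti {𝒟 ℰ : Finset {S : Set X // MeasurableSet S}} (h : 𝒟 ⊆ ℰ) (x : X) :
    genCell ℰ x ⊆ genCell 𝒟 x :=
  fun _ hy S hS => hy S (h hS)

theorem genBoundary_anti {𝒟 ℰ : Finset {S : Set X // MeasurableSet S}} (h : 𝒟 ⊆ ℰ)
    (C : Set X) : genBoundary μ ℰ C ⊆ genBoundary μ 𝒟 C := fun x hx =>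
  ⟨fun h0 => hx.1 (measure_mono_null (inter_subset_inter_left _ (genCell_anti h x)) h0),
    fun h0 => hx.2 (measure_mono_null (sdiff_subset_sdiff_left (genCell_anti h x)) h0)⟩

/-- If some `C ∈ 𝒞` splits any given finite number of positive-measure subsets of `A`, then
`𝒞` contains arbitrarily many sets in general position. -/
theorem exists_atoms_of_forall_split {𝒞 : Set (Set X)} (hm : ∀ C ∈ 𝒞, MeasurableSet C)
    {A : Set X} (hA : MeasurableSet A) (hA0 : μ A ≠ 0)
    (hsplit : ∀ 𝒮 : Set (Set X), 𝒮.Finite →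
      (∀ S ∈ 𝒮, MeasurableSet S ∧ S ⊆ A ∧ μ S ≠ 0) →
        ∃ C ∈ 𝒞, ∀ S ∈ 𝒮, μ (S ∩ C) ≠ 0 ∧ μ (S \ C) ≠ 0) (m : ℕ) :
    ∃ C : ℕ → Set X, (∀ i < m, C i ∈ 𝒞) ∧
      ∀ s : Set ℕ, μ {x ∈ A | ∀ i < m, (x ∈ C i ↔ i ∈ s)} ≠ 0 := by
  classical
  induction m with
  | zero => exact ⟨fun _ => ∅, by simp, by simpa using hA0⟩
  | succ m ih =>
    obtain ⟨C, hC, hatom⟩ := ih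
    let atom : Set ℕ → Set X := fun s => {x ∈ A | ∀ i < m, (x ∈ C i ↔ i ∈ s)}
    have hfin : (atom '' 𝒫 (Iio m)).Finite := ((finite_Iio m).powerset).image _
    obtain ⟨E, hE, hEs⟩ := hsplit _ hfin (by
      rintro _ ⟨s, -, rfl⟩
      refine ⟨?_, fun x hx => hx.1, hatom s⟩
      have : atom s = A ∩ ⋂ i ∈ Iio m, (if i ∈ s then C i else (C i)ᶜ) := by
        ext x
        simp only [atom, mem_ofPred_eq, mem_inter_iff, mem_iInter, mem_Iio]
        refine and_congr_right fun _ => forall₂_congr fun i _ => ?_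
        split_ifs with h <;> simp [h]
      rw [this]
      refine hA.inter (MeasurableSet.biInter (to_countable _) fun i hi => ?_)
      split_ifs
      exacts [hm _ (hC i hi), (hm _ (hC i hi)).compl])
    refine ⟨Function.update C m E, fun i hi => ?_, fun s => ?_⟩
    · rcases Nat.lt_succ_iff_lt_or_eq.1 hi with h | rfl
      · rw [Function.update_of_ne h.ne]
        exact hC i h
      · simpa using hE
    · have heq : ∀ x, (x ∈ atom (s ∩ Iio m) ∧ (x ∈ E ↔ m ∈ s)) →
          x ∈ {x ∈ A | ∀ i < m + 1, (x ∈ Function.update C m E i ↔ i ∈ s)} := by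
        rintro x ⟨⟨hxA, hx⟩, hxE⟩
        refine ⟨hxA, fun i hi => ?_⟩
        rcases Nat.lt_succ_iff_lt_or_eq.1 hi with h | rfl
        · rw [Function.update_of_ne h.ne, hx i h]
          simp [h]
        · simpa using hxE
      obtain ⟨h1, h2⟩ := hEs _ (mem_image_of_mem atom (inter_subset_right (s := s)))
      by_cases hms : m ∈ s
      · exact fun h0 => h1 (measure_mono_null (fun x hx => heq x ⟨hx.1, by simp [hms, hx.2]⟩) h0)
      · exact fun h0 => h2 (measure_mono_null (fun x hx => heq x ⟨hx.1, by simp [hms, hx.2]⟩) h0)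

/-- The measurable sets on which `μ (B i ∩ ·)` vanishes in the limit are closed under
countable unions. -/
theorem tendsto_measure_inter_iUnion_zero [IsFiniteMeasure μ] {ι : Type*} {l : Filter ι}
    {B : ι → Set X} {S : ℕ → Set X} (hS : ∀ n, MeasurableSet (S n))
    (h : ∀ n, Tendsto (fun i => μ (B i ∩ S n)) l (nhds 0)) :
    Tendsto (fun i => μ (B i ∩ ⋃ n, S n)) l (nhds 0) := by
  rw [ENNReal.tendsto_nhds_zero]
  intro ε hε
  have hε2 : 0 < ε / 2 := ENNReal.half_pos hε.ne'
  have hacc : Tendsto (fun m => μ ((⋃ n, S n) \ accumulate S m)) atTop (nhds 0) := by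
    have := tendsto_measure_iInter_atTop (μ := μ) (s := fun m => (⋃ n, S n) \ accumulate S m)
      (fun m => ((MeasurableSet.iUnion hS).diff
        (MeasurableSet.biUnion (to_countable _) fun n _ => hS n)).nullMeasurableSet)
      (fun a b hab => sdiff_subset_sdiff_right (monotone_accumulate hab))
      ⟨0, measure_ne_top _ _⟩
    rwa [← sdiff_iUnion, iUnion_accumulate, sdiff_self, measure_empty] at this
  obtain ⟨m, hm⟩ := ((ENNReal.tendsto_nhds_zero.1 hacc) _ hε2).exists
  have hsum : Tendsto (fun i => ∑ n ∈ Finset.range (m + 1), μ (B i ∩ S n)) l (nhds 0) := by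
    simpa using tendsto_finsetSum (Finset.range (m + 1)) fun n _ => h n
  filter_upwards [(ENNReal.tendsto_nhds_zero.1 hsum) _ hε2] with i hi
  calc μ (B i ∩ ⋃ n, S n)
      ≤ μ ((⋃ n ∈ Finset.range (m + 1), B i ∩ S n) ∪ ((⋃ n, S n) \ accumulate S m)) := by
        refine measure_mono fun x hx => ?_
        by_cases hxa : x ∈ accumulate S m
        · obtain ⟨n, hn, hxn⟩ := mem_accumulate.1 hxa
          exact Or.inl (mem_iUnion₂.2 ⟨n, Finset.mem_range.2 (by omega), hx.1, hxn⟩)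
        · exact Or.inr ⟨hx.2, hxa⟩
    _ ≤ ε / 2 + ε / 2 :=
        (measure_union_le _ _).trans
          (add_le_add ((measure_biUnion_finset_le _ _).trans hi) hm)
    _ = ε := ENNReal.add_halves ε

/-- Classes of measurable sets of finite VC dimension are finitely approximable. -/
theorem FiniteVC.exists_genBoundary_le [IsFiniteMeasure μ] {𝒞 : Set (Set X)}
    (hm : ∀ C ∈ 𝒞, MeasurableSet C) (hvc : FiniteVC 𝒞) {ε : ENNReal} (hε : 0 < ε) :
    ∃ 𝒟 : Finset {S : Set X // MeasurableSet S}, ∀ C ∈ 𝒞, μ (genBoundary μ 𝒟 C) ≤ ε := by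
  classical
  by_contra! hcon
  choose C hC hlt using hcon
  let 𝒰 : Ultrafilter (Finset {S : Set X // MeasurableSet S}) := Ultrafilter.of atTop
  have h𝒰 : (𝒰 : Filter (Finset {S : Set X // MeasurableSet S})) ≤ atTop := Ultrafilter.of_le _
  let B := fun 𝒟 => genBoundary μ 𝒟 (C 𝒟)
  obtain ⟨N, ⟨hNm, hN⟩, hmax⟩ := exists_forall_measure_le_of_iUnion_mem μ
    (𝒩 := {S | MeasurableSet S ∧ Tendsto (fun 𝒟 => μ (B 𝒟 ∩ S)) 𝒰 (nhds 0)})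
    ⟨MeasurableSet.empty, by simp⟩
    fun S hS => ⟨MeasurableSet.iUnion fun n => (hS n).1,
      tendsto_measure_inter_iUnion_zero (fun n => (hS n).1) fun n => (hS n).2⟩
  have hNc : μ Nᶜ ≠ 0 := by
    intro h0
    obtain ⟨𝒟, h𝒟⟩ := ((ENNReal.tendsto_nhds_zero.1 hN) ε hε).exists
    rw [measure_inter_conull h0] at h𝒟
    exact (hlt 𝒟).not_ge h𝒟
  refine not_finiteVC_of_atoms_nonempty (fun m => ?_) hvc
  have hsingle : ∀ S, MeasurableSet S → S ⊆ Nᶜ → μ S ≠ 0 →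
      ∀ᶠ 𝒟 in (𝒰 : Filter _), μ (S ∩ C 𝒟) ≠ 0 ∧ μ (S \ C 𝒟) ≠ 0 := by
    intro S hSm hSN hS0
    have h1 : ∀ᶠ 𝒟 in (𝒰 : Filter _), ¬ μ (B 𝒟 ∩ S) = 0 := by
      rw [Ultrafilter.eventually_not]
      intro h0
      have hNS : Tendsto (fun 𝒟 => μ (B 𝒟 ∩ (N ∪ S))) 𝒰 (nhds 0) := by
        refine tendsto_of_tendsto_of_tendsto_of_le_of_le' tendsto_const_nhds hN
          (Eventually.of_forall fun _ => zero_le) ?_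
        filter_upwards [h0] with 𝒟 h𝒟
        rw [inter_union_distrib_left]
        exact (measure_union_le _ _).trans (by rw [h𝒟, add_zero])
      have := hmax _ ⟨hNm.union hSm, hNS⟩
      rw [measure_union (disjoint_left.2 fun x hxN hxS => hSN hxS hxN) hSm] at this
      exact hS0 (by
        simpa using (ENNReal.add_le_add_iff_left (measure_ne_top μ N)).1
          (this.trans_eq (add_zero _).symm))
    filter_upwards [h1, h𝒰 (eventually_ge_atTop {⟨S, hSm⟩})] with 𝒟 h𝒟 hS𝒟
    obtain ⟨x, hxB, hxS⟩ := nonempty_of_measure_ne_zero h𝒟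
    have hsub : genCell 𝒟 x ⊆ S := fun y hy =>
      (hy ⟨S, hSm⟩ (hS𝒟 (Finset.mem_singleton_self _))).2 hxS
    exact ⟨fun h0 => hxB.1 (measure_mono_null (inter_subset_inter_left _ hsub) h0),
      fun h0 => hxB.2 (measure_mono_null (sdiff_subset_sdiff_left hsub) h0)⟩
  obtain ⟨E, hE, hatom⟩ := exists_atoms_of_forall_split hm hNm.compl hNc (fun 𝒮 hfin h𝒮 => by
    obtain ⟨𝒟, h𝒟⟩ := ((eventually_all_finite hfin).2 fun S hS =>
      hsingle S (h𝒮 S hS).1 (h𝒮 S hS).2.1 (h𝒮 S hS).2.2).exists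
    exact ⟨C 𝒟, hC 𝒟, h𝒟⟩) m
  refine ⟨E, hE, fun s => ?_⟩
  obtain ⟨x, hx⟩ := nonempty_of_measure_ne_zero (hatom s)
  exact ⟨x, hx.2⟩

end Approximation

/-- The section at height `t` of the graph of `f`. -/
def graphSection {X : Type*} (f : X → ℝ) (t : ℝ) : Set X :=
  {x | (x, t) ∈ graphOf f}

theorem measurableSet_graphSection {X : Type*} [MeasurableSpace X] {f : X → ℝ}
    (hf : Measurable f) (t : ℝ) : MeasurableSet (graphSection f t) :=
  ((MeasurableSet.const (0 ≤ t)).inter (measurableSet_le measurable_const hf)).union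
    ((measurableSet_le hf measurable_const).inter (MeasurableSet.const (t ≤ 0)))

theorem FiniteVC.graphSection {X : Type*} {ℱ : Set (X → ℝ)}
    (h : FiniteVC (graphOf '' ℱ)) (t : ℝ) : FiniteVC ((fun f => graphSection f t) '' ℱ) := by
  classical
  obtain ⟨k, hk⟩ := h
  refine ⟨k, fun D hD => ?_⟩
  let e : X ↪ X × ℝ := ⟨fun x => (x, t), fun x y hxy => congrArg Prod.fst hxy⟩
  rw [← Finset.card_map e]
  refine hk _ fun B _ => ?_
  obtain ⟨_, ⟨f, hf, rfl⟩, hfD⟩ := hD (D.filter fun x => (x, t) ∈ B) (Finset.filter_subset _ _)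
  refine ⟨graphOf f, mem_image_of_mem _ hf, fun p hp => ?_⟩
  obtain ⟨x, hx, rfl⟩ := Finset.mem_map.1 hp
  exact (hfD x hx).trans (Finset.mem_filter.trans (and_iff_right hx))

/-- Functions bounded by `K * η` lying in the same graph sections at the multiples of `η` are
within `2 * η` of each other. -/
theorem sub_le_of_graphSection_iff {X : Type*} {f : X → ℝ} {η : ℝ} (hη : 0 < η) {K : ℕ} {x y : X}
    (hx : |f x| ≤ K * η) (hy : |f y| ≤ K * η)
    (h : ∀ j ∈ Finset.Icc (-(K : ℤ)) K,
      (x ∈ graphSection f (j * η) ↔ y ∈ graphSection f (j * η))) :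
    f y - f x ≤ 2 * η := by
  by_contra! hlt
  rw [abs_le] at hx hy
  have hstep : ∀ j : ℤ, f x < j * η → j * η < f y → j = 0 := by
    intro j h1 h2
    have hj : j ∈ Finset.Icc (-(K : ℤ)) K := by
      rw [Finset.mem_Icc]
      constructor
      · have : (-(K : ℝ)) * η < j * η := by linarith
        exact_mod_cast (lt_of_mul_lt_mul_right this hη.le).le
      · have : (j : ℝ) * η < K * η := by linarith
        exact_mod_cast (lt_of_mul_lt_mul_right this hη.le).le
    have hj := h j hj
    simp only [graphSection, graphOf, mem_ofPred_eq, h1.not_ge, h2.le, h1.le, h2.not_ge,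
      and_false, false_and, false_or, or_false, true_and, and_true] at hj
    have h3 : (j : ℝ) * η = 0 := by
      rcases le_total 0 ((j : ℝ) * η) with h0 | h0
      · exact le_antisymm (hj.2 h0) h0
      · exact le_antisymm h0 (hj.1 h0)
    exact_mod_cast (mul_eq_zero.1 h3).resolve_right hη.ne'
  have h1 : f x < (⌊f x / η⌋ + 1 : ℤ) * η := by
    rw [← div_lt_iff₀ hη]
    push_cast
    exact Int.lt_floor_add_one _
  have h2 : (⌊f x / η⌋ : ℝ) * η ≤ f x := by
    rw [← le_div_iff₀ hη]
    exact Int.floor_le _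
  have h3 := hstep (⌊f x / η⌋ + 1) h1 (by push_cast; linarith)
  have h4 := hstep (⌊f x / η⌋ + 1 + 1) (by push_cast at h1 ⊢; linarith) (by
    have : (⌊f x / η⌋ : ℝ) + 1 = 0 := by exact_mod_cast h3
    push_cast at h1 ⊢
    rw [this] at h1 ⊢
    nlinarith)
  omega

section Bracketing

variable {X : Type*} [MeasurableSpace X] {μ : Measure X}

/-- The label of the cell containing `x` of the partition generated by `𝒟`. -/
def genLabel (𝒟 : Finset {S : Set X // MeasurableSet S}) (x : X) : 𝒟 → Prop :=
  fun S => x ∈ S.1.1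

theorem measurable_genLabel (𝒟 : Finset {S : Set X // MeasurableSet S}) :
    Measurable (genLabel 𝒟) :=
  measurable_pi_iff.2 fun S => measurable_mem.2 S.1.2

theorem genLabel_eq_iff {𝒟 : Finset {S : Set X // MeasurableSet S}} {x y : X} :
    genLabel 𝒟 y = genLabel 𝒟 x ↔ y ∈ genCell 𝒟 x := by
  simp [genLabel, genCell, funext_iff]

theorem genCell_congr {𝒟 : Finset {S : Set X // MeasurableSet S}} {x y : X}
    (h : genLabel 𝒟 y = genLabel 𝒟 x) : genCell 𝒟 y = genCell 𝒟 x := by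
  ext z
  rw [← genLabel_eq_iff, ← genLabel_eq_iff, h]

theorem exists_measure_mul_lt_le [IsFiniteMeasure μ] {F : X → ℝ} (hF : Measurable F) {η : ℝ}
    (hη : 0 < η) {δ : ENNReal} (hδ : 0 < δ) : ∃ K : ℕ, μ {x | K * η < F x} ≤ δ := by
  have h := tendsto_measure_iInter_atTop (μ := μ) (s := fun K : ℕ => {x | K * η < F x})
    (fun K => (measurableSet_lt measurable_const hF).nullMeasurableSet)
    (fun a b hab x (hx : b * η < F x) => lt_of_le_of_lt
      (mul_le_mul_of_nonneg_right (Nat.cast_le.2 hab) hη.le) hx)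
    ⟨0, measure_ne_top _ _⟩
  have hemp : (⋂ K : ℕ, {x | K * η < F x}) = ∅ := by
    ext x
    obtain ⟨K, hK⟩ := exists_nat_ge (F x / η)
    simp only [mem_iInter, mem_ofPred_eq, mem_empty_iff_false, iff_false, not_forall, not_lt]
    exact ⟨K, (div_le_iff₀ hη).1 hK⟩
  rw [hemp, measure_empty] at h
  exact ((ENNReal.tendsto_nhds_zero.1 h) δ hδ).exists

/-- One partition which, up to a set of small measure, controls all `f ∈ ℱ` at finitely
many heights. -/
theorem exists_genBoundary_graphSection_le [IsFiniteMeasure μ] {ℱ : Set (X → ℝ)}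
    (hmeas : ∀ f ∈ ℱ, Measurable f) (hgraph : FiniteVC (graphOf '' ℱ)) {ι : Type*}
    (J : Finset ι) (t : ι → ℝ) {δ : ENNReal} (hδ : 0 < δ) :
    ∃ 𝒟 : Finset {S : Set X // MeasurableSet S}, ∀ f ∈ ℱ,
      μ (⋃ j ∈ J, genBoundary μ 𝒟 (graphSection f (t j))) ≤ δ := by
  classical
  have h : ∀ j, ∃ 𝒟 : Finset {S : Set X // MeasurableSet S}, ∀ C ∈
      (fun f => graphSection f (t j)) '' ℱ,
      μ (genBoundary μ 𝒟 C) ≤ δ / J.card := fun j =>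
    (hgraph.graphSection (t j)).exists_genBoundary_le
      (by rintro _ ⟨f, hf, rfl⟩; exact measurableSet_graphSection (hmeas f hf) _)
      (ENNReal.div_pos hδ.ne' (ENNReal.natCast_ne_top _))
  choose 𝒟 h𝒟 using h
  refine ⟨J.biUnion 𝒟, fun f hf => ?_⟩
  calc μ (⋃ j ∈ J, genBoundary μ (J.biUnion 𝒟) (graphSection f (t j)))
      ≤ ∑ j ∈ J, μ (genBoundary μ (J.biUnion 𝒟) (graphSection f (t j))) :=
        measure_biUnion_finset_le _ _
    _ ≤ ∑ _j ∈ J, δ / J.card := Finset.sum_le_sum fun j hj =>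
        (measure_mono (genBoundary_anti (Finset.subset_biUnion_of_mem 𝒟 hj) _)).trans
          (h𝒟 j _ (mem_image_of_mem _ hf))
    _ ≤ δ := by
        rw [Finset.sum_const, nsmul_eq_mul]
        exact ENNReal.mul_div_le

/-- On the cells which no section of the graph of `f` splits, `f` is almost everywhere within
`3 * η` of one of finitely many constants. -/
theorem exists_int_ae_abs_sub_le {f : X → ℝ} {η : ℝ} (hη : 0 < η) {K : ℕ}
    {𝒟 : Finset {S : Set X // MeasurableSet S}} {B : Set X}
    (hB : ∀ j ∈ Finset.Icc (-(K : ℤ)) K, genBoundary μ 𝒟 (graphSection f (j * η)) ⊆ B)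
    (hK : ∀ x ∉ B, |f x| ≤ K * η) (l : 𝒟 → Prop) :
    ∃ c : Finset.Icc (-(K : ℤ)) K,
      ∀ᵐ x ∂μ, genLabel 𝒟 x = l → x ∉ B → |f x - η * (c : ℤ)| ≤ 3 * η := by
  let P : Set X := {x | genLabel 𝒟 x = l}
  have hpat : ∀ᵐ x ∂μ, ∀ j ∈ Finset.Icc (-(K : ℤ)) K, x ∈ P → x ∉ B →
      (x ∈ graphSection f (j * η) ↔ μ (P ∩ graphSection f (j * η)) ≠ 0) := by
    refine (ae_ball_iff (Finset.countable_toSet _)).2 fun j hj => ?_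
    have hcell : ∀ x ∈ P, genCell 𝒟 x = P := fun x hx => by
      ext y
      rw [← genLabel_eq_iff, (hx : genLabel 𝒟 x = l)]
      rfl
    by_cases h0 : μ (P ∩ graphSection f (j * η)) = 0
    · filter_upwards [measure_eq_zero_iff_ae_notMem.1 h0] with x hx hxP _
      simp only [h0, ne_eq, not_true_eq_false, iff_false]
      exact fun hxC => hx ⟨hxP, hxC⟩
    by_cases h1 : μ (P \ graphSection f (j * η)) = 0
    · filter_upwards [measure_eq_zero_iff_ae_notMem.1 h1] with x hx hxP _
      simp only [h0, ne_eq, not_false_eq_true, iff_true]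
      exact by_contra fun hxC => hx ⟨hxP, hxC⟩
    · refine ae_of_all _ fun x hxP hxB => absurd (hB j hj ?_) hxB
      rw [genBoundary, mem_ofPred_eq, hcell x hxP]
      exact ⟨h0, h1⟩
  by_cases hex : ∃ x₀ ∈ P, x₀ ∉ B ∧ ∀ j ∈ Finset.Icc (-(K : ℤ)) K,
      (x₀ ∈ graphSection f (j * η) ↔ μ (P ∩ graphSection f (j * η)) ≠ 0)
  · obtain ⟨x₀, hx₀P, hx₀B, hx₀⟩ := hex
    have hfx₀ := abs_le.1 (hK x₀ hx₀B)
    have hfl : ⌊f x₀ / η⌋ ∈ Finset.Icc (-(K : ℤ)) K := by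
      rw [Finset.mem_Icc]
      constructor
      · rw [Int.le_floor, le_div_iff₀ hη]
        push_cast
        linarith
      · have h1 : (⌊f x₀ / η⌋ : ℝ) ≤ K :=
          (Int.floor_le _).trans ((div_le_iff₀ hη).2 hfx₀.2)
        exact_mod_cast h1
    refine ⟨⟨_, hfl⟩, ?_⟩
    filter_upwards [hpat] with x hx hxP hxB
    have h1 := sub_le_of_graphSection_iff hη (hK x hxB) (hK x₀ hx₀B)
      fun j hj => (hx j hj hxP hxB).trans (hx₀ j hj).symm
    have h2 := sub_le_of_graphSection_iff hη (hK x₀ hx₀B) (hK x hxB)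
      fun j hj => (hx₀ j hj).trans (hx j hj hxP hxB).symm
    have h3 := (le_div_iff₀ hη).1 (Int.floor_le (f x₀ / η))
    have h4 := (div_lt_iff₀ hη).1 (Int.lt_floor_add_one (f x₀ / η))
    rw [abs_le]
    constructor <;> linarith
  · refine ⟨⟨0, by simp⟩, ?_⟩
    filter_upwards [hpat] with x hx hxP hxB
    exact absurd ⟨x, hxP, hxB, fun j hj => hx j hj hxP hxB⟩ hex

/-- **Finite bracketing**: a family of functions with integrable envelope and graphs of finite VC
dimension is covered, for each `ε > 0`, by finitely many brackets `{f | |f - p.1| ≤ p.2 a.e.}`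
with `∫ p.2 ≤ ε`. -/
theorem exists_finite_bracketing [IsProbabilityMeasure μ] {ℱ : Set (X → ℝ)}
    (hmeas : ∀ f ∈ ℱ, Measurable f) {F : X → ℝ} (hF : Measurable F) (hF0 : ∀ x, 0 ≤ F x)
    (henv : ∀ f ∈ ℱ, ∀ x, |f x| ≤ F x) (hgraph : FiniteVC (graphOf '' ℱ))
    (hFint : Integrable F μ) {ε : ℝ} (hε : 0 < ε) :
    ∃ 𝓑 : Set ((X → ℝ) × (X → ℝ)), 𝓑.Finite ∧
      (∀ p ∈ 𝓑, (Measurable p.1 ∧ Integrable p.1 μ) ∧ (Measurable p.2 ∧ Integrable p.2 μ) ∧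
        ∫ x, p.2 x ∂μ ≤ ε) ∧
      ∀ f ∈ ℱ, ∃ p ∈ 𝓑, ∀ᵐ x ∂μ, |f x - p.1 x| ≤ p.2 x := by
  classical
  obtain ⟨η, hη, hηε⟩ : ∃ η : ℝ, 0 < η ∧ 3 * η = ε / 2 := ⟨ε / 6, by positivity, by ring⟩
  have hlint : ∫⁻ x, ENNReal.ofReal (F x) ∂μ ≠ ⊤ := by
    rw [← ofReal_integral_eq_lintegral_ofReal hFint (ae_of_all _ hF0)]
    exact ENNReal.ofReal_ne_top
  obtain ⟨δ₀, hδ₀, hsmall⟩ := exists_pos_setLIntegral_lt_of_measure_lt hlint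
    (ε := ENNReal.ofReal (ε / 2)) (ENNReal.ofReal_pos.2 (half_pos hε)).ne'
  obtain ⟨δ, hδ, hδδ₀⟩ := exists_between hδ₀
  have hδ2 : 0 < δ / 2 := ENNReal.half_pos hδ.ne'
  obtain ⟨K, hK⟩ := exists_measure_mul_lt_le (μ := μ) hF hη hδ2
  obtain ⟨𝒟₀, h𝒟₀⟩ := exists_genBoundary_graphSection_le (μ := μ) hmeas hgraph
    (Finset.Icc (-(K : ℤ)) K) (fun j => j * η) hδ2
  let T : {S : Set X // MeasurableSet S} :=
    ⟨{x | K * η < F x}, measurableSet_lt measurable_const hF⟩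
  let 𝒟 := insert T 𝒟₀
  let h : ((𝒟 → Prop) → Finset.Icc (-(K : ℤ)) K) → X → ℝ := fun a x => η * (a (genLabel 𝒟 x) : ℤ)
  let w : Set (𝒟 → Prop) → X → ℝ := fun s x => 3 * η + (genLabel 𝒟 ⁻¹' s).indicator F x
  have hsm : ∀ s : Set (𝒟 → Prop), MeasurableSet (genLabel 𝒟 ⁻¹' s) := fun s =>
    measurable_genLabel 𝒟 s.toFinite.measurableSet
  have hind : ∀ s, Integrable ((genLabel 𝒟 ⁻¹' s).indicator F) μ := fun s =>
    hFint.indicator (hsm s)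
  have hhm : ∀ a, Measurable (h a) := fun a =>
    (measurable_of_finite fun l => η * ((a l : ℤ) : ℝ)).comp (measurable_genLabel 𝒟)
  refine ⟨range (fun q : ((𝒟 → Prop) → Finset.Icc (-(K : ℤ)) K) × Set (𝒟 → Prop) =>
    (h q.1, w q.2)) ∩ {p | ∫ x, p.2 x ∂μ ≤ ε}, (finite_range _).inter_of_left _, ?_, ?_⟩
  · rintro _ ⟨⟨⟨a, s⟩, rfl⟩, hp⟩
    refine ⟨⟨hhm a, ?_⟩, ⟨measurable_const.add (hF.indicator (hsm s)),
      (integrable_const _).add (hind s)⟩, hp⟩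
    refine Integrable.of_bound (hhm a).aestronglyMeasurable (η * K) (ae_of_all _ fun x => ?_)
    have ha := Finset.mem_Icc.1 (a (genLabel 𝒟 x)).2
    rw [Real.norm_eq_abs, abs_mul, abs_of_pos hη]
    refine mul_le_mul_of_nonneg_left ?_ hη.le
    rw [← Int.cast_abs]
    exact_mod_cast abs_le.2 ha
  · intro f hf
    let B : Set X := T.1 ∪ ⋃ j ∈ Finset.Icc (-(K : ℤ)) K, genBoundary μ 𝒟 (graphSection f (j * η))
    have hBμ : μ B ≤ δ := by
      refine (measure_union_le _ _).trans ((add_le_add hK ?_).trans (ENNReal.add_halves δ).le)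
      exact (measure_mono (iUnion₂_mono fun j _ =>
        genBoundary_anti (Finset.subset_insert T 𝒟₀) _)).trans (h𝒟₀ f hf)
    have hBsat : ∀ x y, genLabel 𝒟 y = genLabel 𝒟 x → x ∈ B → y ∈ B := by
      rintro x y hxy (hx | hx)
      · exact Or.inl ((genLabel_eq_iff.1 hxy T (Finset.mem_insert_self _ _)).2 hx)
      · refine Or.inr ?_
        simp only [mem_iUnion, genBoundary, mem_ofPred_eq] at hx ⊢
        rwa [genCell_congr hxy]
    let bad : Set (𝒟 → Prop) := genLabel 𝒟 '' B
    have hbad : genLabel 𝒟 ⁻¹' bad = B := by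
      ext y
      exact ⟨fun ⟨x, hx, hxy⟩ => hBsat x y hxy.symm hx, fun hy => ⟨y, hy, rfl⟩⟩
    choose c hc using exists_int_ae_abs_sub_le (μ := μ) (f := f) (𝒟 := 𝒟) (B := B) hη
      (fun j hj => (subset_biUnion_of_mem (u := fun j : ℤ =>
        genBoundary μ 𝒟 (graphSection f (j * η))) hj).trans subset_union_right)
      (fun x hx => (henv f hf x).trans (not_lt.1 fun hlt => hx (Or.inl hlt)))
    let a : (𝒟 → Prop) → Finset.Icc (-(K : ℤ)) K := fun l =>
      if l ∈ bad then ⟨0, by simp⟩ else c l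
    refine ⟨(h a, w bad), ⟨⟨(a, bad), rfl⟩, ?_⟩, ?_⟩
    · have h1 : ∫ x in B, F x ∂μ ≤ ε / 2 := by
        rw [integral_eq_lintegral_of_nonneg_ae (ae_of_all _ hF0)
          hF.aestronglyMeasurable]
        exact ENNReal.toReal_le_of_le_ofReal (half_pos hε).le
          (hsmall B (hBμ.trans_lt hδδ₀)).le
      have h2 : ∫ x, w bad x ∂μ = 3 * η + ∫ x in B, F x ∂μ := by
        simp only [w]
        rw [integral_add (integrable_const _) (hind bad), integral_indicator (hsm bad), hbad]
        simp
      rw [mem_ofPred_eq, h2]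
      linarith
    · filter_upwards [ae_all_iff.2 hc] with x hx
      simp only [h, w, a, hbad]
      by_cases hxB : x ∈ B
      · have : genLabel 𝒟 x ∈ bad := ⟨x, hxB, rfl⟩
        simp only [this, if_true, indicator_of_mem hxB, Int.cast_zero, mul_zero, sub_zero]
        linarith [henv f hf x]
      · have : genLabel 𝒟 x ∉ bad := fun hb => hxB (hbad ▸ hb)
        simpa only [this, if_false, indicator_of_notMem hxB, add_zero] using
          hx (genLabel 𝒟 x) rfl hxB

end Bracketing

/-- The deviation of an average is controlled by the deviations of an enclosing bracket. -/
theorem abs_birkhoffAverage_sub_integral_le {X Ω : Type*} [MeasurableSpace X] {μ : Measure X}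
    {f h w : X → ℝ} (hf : Integrable f μ) (hh : Integrable h μ) (hw : Integrable w μ)
    (hfw : ∀ᵐ x ∂μ, |f x - h x| ≤ w x) {T : Ω → Ω} {X₁ : Ω → X} {ω : Ω}
    (hω : ∀ i, |f (X₁ (T^[i] ω)) - h (X₁ (T^[i] ω))| ≤ w (X₁ (T^[i] ω))) (n : ℕ) :
    |birkhoffAverage ℝ T (f ∘ X₁) n ω - ∫ x, f x ∂μ| ≤
      |birkhoffAverage ℝ T (h ∘ X₁) n ω - ∫ x, h x ∂μ| +
        |birkhoffAverage ℝ T (w ∘ X₁) n ω - ∫ x, w x ∂μ| + 2 * ∫ x, w x ∂μ := by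
  have h1 : |∫ x, f x ∂μ - ∫ x, h x ∂μ| ≤ ∫ x, w x ∂μ := by
    rw [← integral_sub hf hh]
    exact (abs_integral_le_integral_abs).trans (integral_mono_ae (hf.sub hh).abs hw hfw)
  have h2 : |birkhoffAverage ℝ T (f ∘ X₁) n ω - birkhoffAverage ℝ T (h ∘ X₁) n ω| ≤
      birkhoffAverage ℝ T (w ∘ X₁) n ω := by
    simp only [birkhoffAverage, birkhoffSum, smul_eq_mul, Function.comp_apply]
    rw [← mul_sub, abs_mul, abs_of_nonneg (by positivity : (0 : ℝ) ≤ (n : ℝ)⁻¹),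
      ← Finset.sum_sub_distrib]
    exact mul_le_mul_of_nonneg_left
      ((Finset.abs_sum_le_sum_abs _ _).trans (Finset.sum_le_sum fun i _ => hω i)) (by positivity)
  have h3 := le_abs_self (birkhoffAverage ℝ T (w ∘ X₁) n ω - ∫ x, w x ∂μ)
  have h4 := abs_le.1 h1
  have h5 := abs_le.1 h2
  have h6 := neg_abs_le (birkhoffAverage ℝ T (h ∘ X₁) n ω - ∫ x, h x ∂μ)
  have h7 := le_abs_self (birkhoffAverage ℝ T (h ∘ X₁) n ω - ∫ x, h x ∂μ)
  rw [abs_le]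
  constructor <;> linarith

/-- A bound on the deviation of averages passes to dominated pointwise limits. -/
theorem abs_average_sub_integral_le_of_tendsto {X : Type*} [MeasurableSpace X] {μ : Measure X}
    {F f : X → ℝ} (hF : Integrable F μ) {g : ℕ → X → ℝ} (hg : ∀ k, Measurable (g k))
    (hgF : ∀ k x, |g k x| ≤ F x) (hlim : ∀ x, Tendsto (fun k => g k x) atTop (nhds (f x)))
    (y : ℕ → X) (n : ℕ) {ε : ℝ}
    (h : ∀ k, |(n : ℝ)⁻¹ * ∑ i ∈ Finset.range n, g k (y i) - ∫ x, g k x ∂μ| ≤ ε) :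
    |(n : ℝ)⁻¹ * ∑ i ∈ Finset.range n, f (y i) - ∫ x, f x ∂μ| ≤ ε := by
  have h1 := tendsto_integral_of_dominated_convergence F
    (fun k => (hg k).aestronglyMeasurable) hF
    (fun k => ae_of_all μ fun x => (hgF k x)) (ae_of_all μ hlim)
  exact le_of_tendsto' (((tendsto_finsetSum _ fun i _ => hlim (y i)).const_mul _).sub h1).abs h

/-- **Ergodic ULLN for VC graph families.** If the family of graphs `𝒢(ℱ)` of the
separable family `ℱ` has finite VC dimension and the envelope `F` is integrable under the
marginal `μ` of a stationary ergodic process, then the empirical means converge uniformly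
over `ℱ`, almost surely. -/
theorem ergodic_ulln_vc_graph {X : Type*} [MeasurableSpace X]
    (ℱ : Set (X → ℝ)) (hmeas : ∀ f ∈ ℱ, Measurable f) (hsep : SeparableFamily ℱ)
    (F : X → ℝ) (hF : Measurable F) (hF0 : ∀ x, 0 ≤ F x)
    (henv : ∀ f ∈ ℱ, ∀ x, |f x| ≤ F x)
    (hgraph : FiniteVC (graphOf '' ℱ))
    {Ω : Type*} [MeasurableSpace Ω] (ℙ : Measure Ω) [IsProbabilityMeasure ℙ]
    (T : Ω → Ω) (hT : Ergodic T ℙ) (X₁ : Ω → X) (hX₁ : Measurable X₁)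
    (μ : Measure X) (hμ : Measure.map X₁ ℙ = μ) (hFint : Integrable F μ) :
    ∀ᵐ ω ∂ℙ, Filter.Tendsto
      (fun n : ℕ => ⨆ f : ℱ, |(n : ℝ)⁻¹ * ∑ i ∈ Finset.range n,
          (f : X → ℝ) (X₁ (T^[i] ω)) - ∫ x, (f : X → ℝ) x ∂μ|)
      Filter.atTop (nhds 0) := by
  subst hμ
  have : IsProbabilityMeasure (Measure.map X₁ ℙ) :=
    Measure.isProbabilityMeasure_map hX₁.aemeasurable
  set μ := Measure.map X₁ ℙ
  have hint : ∀ f ∈ ℱ, Integrable f μ := fun f hf =>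
    hFint.mono' (hmeas f hf).aestronglyMeasurable (ae_of_all _ (henv f hf))
  have hbirk : ∀ g : X → ℝ, Measurable g → Integrable g μ → ∀ᵐ ω ∂ℙ,
      Tendsto (fun n => |birkhoffAverage ℝ T (g ∘ X₁) n ω - ∫ x, g x ∂μ|) atTop (nhds 0) := by
    intro g hg hgi
    filter_upwards [hT.ae_tendsto_birkhoffAverage (hg.comp hX₁) (hgi.comp_measurable hX₁)]
      with ω hω
    rw [integral_map hX₁.aemeasurable hg.aestronglyMeasurable]
    simpa using (hω.sub_const (∫ ω, g (X₁ ω) ∂ℙ)).abs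
  obtain ⟨ℱ₀, hsub, hcount, hdense⟩ := hsep
  have hunif : ∀ ε : ℝ, 0 < ε → ∀ᵐ ω ∂ℙ, ∀ᶠ n : ℕ in atTop, ∀ f ∈ ℱ₀,
      |(n : ℝ)⁻¹ * ∑ i ∈ Finset.range n, f (X₁ (T^[i] ω)) - ∫ x, f x ∂μ| ≤ ε := by
    intro ε hε
    obtain ⟨𝓑, hfin, h𝓑, hcov⟩ := exists_finite_bracketing hmeas hF hF0 henv hgraph hFint
      (show 0 < ε / 4 by positivity)
    choose! p hp𝓑 hp using hcov
    have hlim1 : ∀ᵐ ω ∂ℙ, ∀ q ∈ 𝓑, Tendsto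
        (fun n => |birkhoffAverage ℝ T (q.1 ∘ X₁) n ω - ∫ x, q.1 x ∂μ|) atTop (nhds 0) :=
      (ae_ball_iff hfin.countable).2 fun q hq => hbirk _ (h𝓑 q hq).1.1 (h𝓑 q hq).1.2
    have hlim2 : ∀ᵐ ω ∂ℙ, ∀ q ∈ 𝓑, Tendsto
        (fun n => |birkhoffAverage ℝ T (q.2 ∘ X₁) n ω - ∫ x, q.2 x ∂μ|) atTop (nhds 0) :=
      (ae_ball_iff hfin.countable).2 fun q hq => hbirk _ (h𝓑 q hq).2.1.1 (h𝓑 q hq).2.1.2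
    have horbit : ∀ᵐ ω ∂ℙ, ∀ f ∈ ℱ₀, ∀ i : ℕ,
        |f (X₁ (T^[i] ω)) - (p f).1 (X₁ (T^[i] ω))| ≤ (p f).2 (X₁ (T^[i] ω)) :=
      (ae_ball_iff hcount).2 fun f hf => ae_all_iff.2 fun i =>
        (hT.toMeasurePreserving.iterate i).quasiMeasurePreserving.ae
          (ae_of_ae_map hX₁.aemeasurable (hp f (hsub hf)))
    filter_upwards [hlim1, hlim2, horbit] with ω h1 h2 h3
    have h4 : ∀ᶠ n : ℕ in atTop, ∀ q ∈ 𝓑,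
        |birkhoffAverage ℝ T (q.1 ∘ X₁) n ω - ∫ x, q.1 x ∂μ| < ε / 4 ∧
          |birkhoffAverage ℝ T (q.2 ∘ X₁) n ω - ∫ x, q.2 x ∂μ| < ε / 4 :=
      (eventually_all_finite hfin).2 fun q hq =>
        ((h1 q hq).eventually_lt_const (by positivity)).and
          ((h2 q hq).eventually_lt_const (by positivity))
    filter_upwards [h4] with n hn f hf
    have hb := h𝓑 _ (hp𝓑 f (hsub hf))
    have hdev := abs_birkhoffAverage_sub_integral_le (hint f (hsub hf)) hb.1.2 hb.2.1.2
      (hp f (hsub hf)) (h3 f hf) n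
    obtain ⟨hn1, hn2⟩ := hn _ (hp𝓑 f (hsub hf))
    calc |(n : ℝ)⁻¹ * ∑ i ∈ Finset.range n, f (X₁ (T^[i] ω)) - ∫ x, f x ∂μ|
        = |birkhoffAverage ℝ T (f ∘ X₁) n ω - ∫ x, f x ∂μ| := rfl
      _ ≤ ε := by linarith [hb.2.2]
  have hunif' : ∀ᵐ ω ∂ℙ, ∀ m : ℕ, ∀ᶠ n : ℕ in atTop, ∀ f ∈ ℱ₀,
      |(n : ℝ)⁻¹ * ∑ i ∈ Finset.range n, f (X₁ (T^[i] ω)) - ∫ x, f x ∂μ| ≤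
        1 / ((m : ℝ) + 1) :=
    ae_all_iff.2 fun m => hunif _ (by positivity)
  filter_upwards [hunif'] with ω hω
  rw [Metric.tendsto_nhds]
  intro ε hε
  obtain ⟨m, hm⟩ := exists_nat_one_div_lt hε
  filter_upwards [hω m] with n hn
  rw [Real.dist_0_eq_abs, abs_of_nonneg (Real.iSup_nonneg fun _ => abs_nonneg _)]
  refine lt_of_le_of_lt (Real.iSup_le (fun f => ?_) (by positivity)) hm
  obtain ⟨g, hg, hlim⟩ := hdense f f.2
  exact abs_average_sub_integral_le_of_tendsto hFint (fun k => hmeas _ (hsub (hg k)))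
    (fun k => henv _ (hsub (hg k))) hlim (fun i => X₁ (T^[i] ω)) n fun k => hn _ (hg k)
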